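/- Let X be a Peano continuum having a free arc, which is neither an arc nor a circle, and let F be a commutative subsemigroup of C^0(X) consisting of continuous open maps that is sensitive with sensitivity constant c > 0. If K is a free arc contained in a maximal free open interval of X, then there exist g ∈ F and a subarc L ⊆ K such that g(L) is a free arc of X whose two endpoints are at distance exactly c from each other. -/

import Mathlib

open Set Metric Topology

/-- The whole space `X` is an arc, i.e. homeomorphic to `[0,1]`. -/
def SpaceIsArc (X : Type*) [TopologicalSpace X] : Prop :=
  Nonempty (X ≃ₜ Set.Icc (0:ℝ) 1)

/-- The whole space `X` is a circle, i.e. homeomorphic to the unit circle in `ℂ`. -/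
def SpaceIsCircle (X : Type*) [TopologicalSpace X] : Prop :=
  Nonempty (X ≃ₜ Metric.sphere (0:ℂ) 1)

/-- A subset `A` is an arc: with the subspace topology it is homeomorphic to `[0,1]`. -/
def IsArc {X : Type*} [TopologicalSpace X] (A : Set X) : Prop :=
  Nonempty (A ≃ₜ Set.Icc (0:ℝ) 1)

/-- A subset `A` is a circle: with the subspace topology it is homeomorphic to `S¹`. -/
def IsCircleSet {X : Type*} [TopologicalSpace X] (A : Set X) : Prop :=
  Nonempty (A ≃ₜ Metric.sphere (0:ℂ) 1)

/-- `A` is an arc with endpoints `a` and `b`: it is the image of a continuous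
injective parametrization of `[0,1]` with `γ 0 = a` and `γ 1 = b`. -/
def IsArcEnds {X : Type*} [TopologicalSpace X] (A : Set X) (a b : X) : Prop :=
  ∃ γ : ℝ → X, ContinuousOn γ (Set.Icc 0 1) ∧ Set.InjOn γ (Set.Icc 0 1) ∧
    γ '' Set.Icc 0 1 = A ∧ γ 0 = a ∧ γ 1 = b

/-- A free open interval: an open subset homeomorphic to `(0,1)`. -/
def IsFreeOpenInterval {X : Type*} [TopologicalSpace X] (J : Set X) : Prop :=
  IsOpen J ∧ Nonempty (J ≃ₜ Set.Ioo (0:ℝ) 1)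

/-- A free arc: the closure of a free open interval, homeomorphic to `[0,1]`. -/
def IsFreeArc {X : Type*} [TopologicalSpace X] (A : Set X) : Prop :=
  ∃ J : Set X, IsFreeOpenInterval J ∧ A = closure J ∧ IsArc A

/-- A maximal free open interval: no free open interval properly contains it. -/
def IsMaxFreeOpenInterval {X : Type*} [TopologicalSpace X] (J : Set X) : Prop :=
  IsFreeOpenInterval J ∧ ∀ K : Set X, IsFreeOpenInterval K → J ⊆ K → J = K

/-- `x` is an endpoint of the space `X`: every open set containing `x` contains an
open neighborhood of `x` whose boundary is a single point. -/
def IsEndpointOf (X : Type*) [TopologicalSpace X] (x : X) : Prop :=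
  ∀ U : Set X, IsOpen U → x ∈ U → ∃ V : Set X, IsOpen V ∧ x ∈ V ∧ V ⊆ U ∧
    ∃ y : X, frontier V = {y}

/-- A maximal free open interval of Type I: its closure is an arc `J ∪ {a,b}` with
`a, b ∉ J` and at least one of `a, b` an endpoint of `X`. -/
def IsTypeI {X : Type*} [TopologicalSpace X] (J : Set X) : Prop :=
  IsMaxFreeOpenInterval J ∧ ∃ a b : X, a ≠ b ∧ a ∉ J ∧ b ∉ J ∧
    closure J = J ∪ {a, b} ∧ IsArcEnds (closure J) a b ∧
    (IsEndpointOf X a ∨ IsEndpointOf X b)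

/-- The model simple triod in the complex plane: three unit segments from the
origin in directions `π/3`, `π`, `5π/3`. -/
noncomputable def triodModel : Set ℂ :=
  ⋃ θ ∈ ({Real.pi / 3, Real.pi, 5 * Real.pi / 3} : Set ℝ),
    (fun r : ℝ => (r : ℂ) * Complex.exp (θ * Complex.I)) '' Set.Icc (0:ℝ) 1

/-- `A` is a simple triod. -/
def IsSimpleTriod {X : Type*} [TopologicalSpace X] (A : Set X) : Prop :=
  Nonempty (A ≃ₜ triodModel)

/-- `U` contains no simple triod. -/
def ContainsNoTriod {X : Type*} [TopologicalSpace X] (U : Set X) : Prop :=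
  ∀ A : Set X, A ⊆ U → ¬ IsSimpleTriod A

/-- The distance between two subsets of a metric space:
`d(S,T) = inf { dist s t | s ∈ S, t ∈ T }`. -/
noncomputable def setDist {X : Type*} [MetricSpace X] (S T : Set X) : ℝ :=
  sInf (Set.image2 dist S T)

/-- A continuous injective parametrization on `[x,y]` gives an arc from `h x` to `h y`. -/
theorem isArcEnds_image_Icc {X : Type*} [TopologicalSpace X] {h : ℝ → X} {x y : ℝ} (hxy : x < y)
    (hc : ContinuousOn h (Icc x y)) (hi : InjOn h (Icc x y)) :
    IsArcEnds (h '' Icc x y) (h x) (h y) := by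
  have him : (fun t : ℝ => (y - x) * t + x) '' Icc 0 1 = Icc x y := by
    rw [image_affine_Icc' (sub_pos.2 hxy)]; simp
  have hm : MapsTo (fun t : ℝ => (y - x) * t + x) (Icc 0 1) (Icc x y) :=
    mapsTo_iff_image_subset.2 him.subset
  refine ⟨fun t => h ((y - x) * t + x), hc.comp (by fun_prop) hm, ?_, ?_, by simp, by simp⟩
  · intro a ha b hb hab
    have := hi (hm ha) (hm hb) hab
    have h2 : (y - x) * (a - b) = 0 := by linarith
    rcases mul_eq_zero.1 h2 with h3 | h3 <;> linarith
  · rw [← him, image_image]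

theorem isEmbedding_restrict_Icc {X : Type*} [TopologicalSpace X] [T2Space X] {h : ℝ → X}
    {x y : ℝ} (hc : ContinuousOn h (Icc x y)) (hi : InjOn h (Icc x y)) :
    IsEmbedding ((Icc x y).domRestrict h) :=
  (hc.domRestrict.isClosedEmbedding (injOn_iff_injective.1 hi)).isEmbedding

theorem IsArcEnds.isArc {X : Type*} [TopologicalSpace X] [T2Space X] {A : Set X} {a b : X}
    (h : IsArcEnds A a b) : IsArc A := by
  obtain ⟨γ, hc, hi, rfl, -, -⟩ := h
  refine ⟨((isEmbedding_restrict_Icc hc hi).toHomeomorph.trans (Homeomorph.setCongr ?_)).symm⟩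
  rw [range_domRestrict]

/-- The image of an open interval under an embedding of its closure is homeomorphic to `(0,1)`. -/
theorem nonempty_homeomorph_image_Ioo {X : Type*} [TopologicalSpace X] [T2Space X] {h : ℝ → X}
    {x y : ℝ} (hxy : x < y) (hc : ContinuousOn h (Icc x y)) (hi : InjOn h (Icc x y)) :
    Nonempty (h '' Ioo x y ≃ₜ Ioo (0:ℝ) 1) := by
  have he : IsEmbedding ((Ioo x y).domRestrict h) :=
    (isEmbedding_restrict_Icc hc hi).comp (IsEmbedding.inclusion Ioo_subset_Icc_self)
  have e₁ : Ioo x y ≃ₜ h '' Ioo x y :=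
    he.toHomeomorph.trans (Homeomorph.setCongr (range_domRestrict _ _))
  let a : ℝ ≃ₜ ℝ := affineHomeomorph (y - x) x (sub_pos.2 hxy).ne'
  have ha : a '' Ioo 0 1 = Ioo x y := by
    have := image_affine_Ioo (sub_pos.2 hxy) x 0 1
    simpa [a] using this
  exact ⟨(((a.image (Ioo 0 1)).trans (Homeomorph.setCongr ha)).trans e₁).symm⟩

theorem isFreeArc_image_Icc {X : Type*} [TopologicalSpace X] [T2Space X] {h : ℝ → X} {x y : ℝ}
    (hxy : x < y) (hc : ContinuousOn h (Icc x y)) (hi : InjOn h (Icc x y))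
    (ho : IsOpen (h '' Ioo x y)) : IsFreeArc (h '' Icc x y) := by
  refine ⟨h '' Ioo x y, ⟨ho, nonempty_homeomorph_image_Ioo hxy hc hi⟩, ?_,
    (isArcEnds_image_Icc hxy hc hi).isArc⟩
  apply Subset.antisymm
  · rw [← closure_Ioo hxy.ne] at hc ⊢
    exact hc.image_closure
  · exact closure_minimal (image_mono Ioo_subset_Icc_self) (isCompact_Icc.image_of_continuousOn hc).isClosed

/-- For a continuous `g` on `[x,y]`, open on open subintervals, with values in a connected space:
if no proper subinterval has endpoints sent as far apart as those of `[x,y]`, then `g` is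
injective on `[x,y]`. -/
theorem injOn_Icc_of_shortest {X : Type*} [MetricSpace X] [PreconnectedSpace X] {g : ℝ → X}
    {x y c : ℝ} (hg : ContinuousOn g (Icc x y))
    (ho : ∀ a b, x ≤ a → b ≤ y → IsOpen (g '' Ioo a b)) (hd : c ≤ dist (g x) (g y))
    (hmin : ∀ a b, x ≤ a → a ≤ b → b ≤ y → c ≤ dist (g a) (g b) → y - x ≤ b - a) :
    InjOn g (Icc x y) := by
  suffices H : ∀ a b, x ≤ a → b ≤ y → g a = g b → ¬ a < b by
    intro a ha b hb hab
    exact le_antisymm (not_lt.1 (H b a hb.1 ha.2 hab.symm)) (not_lt.1 (H a b ha.1 hb.2 hab))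
  intro a b hxa hby hgab hab
  have hcpt : IsCompact {q : ℝ × ℝ | q ∈ Icc x y ×ˢ Icc x y ∧ g q.1 = g q.2} := by
    have hcl : IsClosed (Icc x y ×ˢ Icc x y ∩ (fun q : ℝ × ℝ => dist (g q.1) (g q.2)) ⁻¹' {0}) := by
      refine ContinuousOn.preimage_isClosed_of_isClosed ?_
        (isClosed_Icc.prod isClosed_Icc) isClosed_singleton
      exact continuous_dist.comp_continuousOn ((hg.comp continuousOn_fst fun q hq => hq.1).prodMk
        (hg.comp continuousOn_snd fun q hq => hq.2))
    convert (isCompact_Icc.prod isCompact_Icc).of_isClosed_subset hcl inter_subset_left using 1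
    ext q
    simp
  obtain ⟨⟨s, t⟩, ⟨⟨⟨hxs, hsy⟩, hxt, hty⟩, hst⟩, hmax⟩ := hcpt.exists_isMaxOn
    ⟨(a, b), ⟨⟨⟨hxa, by linarith⟩, by linarith, hby⟩, hgab⟩⟩
    (f := fun q : ℝ × ℝ => q.2 - q.1) (by fun_prop)
  dsimp only at hxs hsy hxt hty hst
  have hmax' : ∀ u v, x ≤ u → u ≤ y → x ≤ v → v ≤ y → g u = g v → v - u ≤ t - s :=
    fun u v h1 h2 h3 h4 h5 => hmax (show (u, v) ∈ _ from ⟨⟨⟨h1, h2⟩, h3, h4⟩, h5⟩)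
  have hlt : s < t := by
    have := hmax' a b hxa (by linarith) (by linarith) hby hgab
    linarith
  rcases hxs.eq_or_lt with rfl | hxs'
  · have := hmin t y hxt hty le_rfl (hst ▸ hd)
    linarith
  rcases hty.eq_or_lt with rfl | hty'
  · have := hmin x s le_rfl hxs hsy (hst ▸ hd)
    linarith
  have heq : g '' Icc s t = g '' Ioo x t ∩ g '' Ioo s y := by
    ext z
    constructor
    · rintro ⟨r, ⟨hsr, hrt⟩, rfl⟩
      have hs : g s ∈ g '' Ioo x t ∩ g '' Ioo s y :=
        ⟨⟨s, ⟨hxs', hlt⟩, rfl⟩, ⟨t, ⟨hlt, hty'⟩, hst.symm⟩⟩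
      rcases hsr.eq_or_lt with rfl | h1
      · exact hs
      rcases hrt.eq_or_lt with rfl | h2
      · exact hst ▸ hs
      exact ⟨⟨r, ⟨by linarith, h2⟩, rfl⟩, ⟨r, ⟨h1, by linarith⟩, rfl⟩⟩
    · rintro ⟨⟨u, ⟨hxu, hut⟩, rfl⟩, v, ⟨hsv, hvy⟩, huv⟩
      by_cases hu : s ≤ u
      · exact ⟨u, ⟨hu, hut.le⟩, rfl⟩
      by_cases hv : v ≤ t
      · exact ⟨v, ⟨hsv.le, hv⟩, huv⟩
      have := hmax' u v hxu.le (by linarith) (by linarith) hvy.le huv.symm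
      linarith
  have huniv : g '' Icc s t = univ := by
    refine IsClopen.eq_univ ⟨?_, ?_⟩ ((nonempty_Icc.2 hlt.le).image g)
    · exact (isCompact_Icc.image_of_continuousOn (hg.mono (Icc_subset_Icc hxs hty))).isClosed
    · rw [heq]
      exact (ho x t le_rfl hty).inter (ho s y hxs le_rfl)
  obtain ⟨u, hu, hgu⟩ : g x ∈ g '' Icc s t := huniv ▸ mem_univ _
  obtain ⟨v, hv, hgv⟩ : g y ∈ g '' Icc s t := huniv ▸ mem_univ _
  rw [← hgu, ← hgv] at hd
  rcases le_total u v with h | h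
  · have := hmin u v (by linarith [hu.1]) h (by linarith [hv.2]) hd
    linarith [hu.1, hv.2]
  · have := hmin v u (by linarith [hv.1]) h (by linarith [hu.2]) (dist_comm (g u) (g v) ▸ hd)
    linarith [hv.1, hu.2]

/-- A continuous map on `[x,y]`, open on open subintervals, with values in a connected space and
with endpoints sent at distance at least `c > 0`, is injective on some `[a,b] ⊆ [x,y]` whose
endpoints are sent at distance exactly `c`. -/
theorem exists_injOn_Icc_dist_eq {X : Type*} [MetricSpace X] [PreconnectedSpace X] {g : ℝ → X}
    {x y c : ℝ} (hc : 0 < c) (hxy : x ≤ y) (hg : ContinuousOn g (Icc x y))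
    (ho : ∀ a b, x ≤ a → b ≤ y → IsOpen (g '' Ioo a b)) (hd : c ≤ dist (g x) (g y)) :
    ∃ a b, x ≤ a ∧ a < b ∧ b ≤ y ∧ InjOn g (Icc a b) ∧ dist (g a) (g b) = c := by
  have hcpt : IsCompact {q : ℝ × ℝ | (q ∈ Icc x y ×ˢ Icc x y ∧ q.1 ≤ q.2) ∧
      c ≤ dist (g q.1) (g q.2)} := by
    have hcl : IsClosed ({q : ℝ × ℝ | q ∈ Icc x y ×ˢ Icc x y ∧ q.1 ≤ q.2} ∩
        (fun q : ℝ × ℝ => dist (g q.1) (g q.2)) ⁻¹' Ici c) := by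
      refine ContinuousOn.preimage_isClosed_of_isClosed ?_
        ((isClosed_Icc.prod isClosed_Icc).inter (isClosed_le continuous_fst continuous_snd))
        isClosed_Ici
      exact continuous_dist.comp_continuousOn ((hg.comp continuousOn_fst fun q hq => hq.1.1).prodMk
        (hg.comp continuousOn_snd fun q hq => hq.1.2))
    exact (isCompact_Icc.prod isCompact_Icc).of_isClosed_subset hcl fun q hq => hq.1.1
  obtain ⟨⟨a, b⟩, ⟨⟨⟨⟨hxa, hay⟩, hxb, hby⟩, hab⟩, hdab⟩, hmin⟩ := hcpt.exists_isMinOn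
    ⟨(x, y), ⟨⟨⟨⟨le_rfl, hxy⟩, hxy, le_rfl⟩, hxy⟩, hd⟩⟩
    (f := fun q : ℝ × ℝ => q.2 - q.1) (by fun_prop)
  dsimp only at hxa hay hxb hby hab hdab
  have hmin' : ∀ u v, a ≤ u → u ≤ v → v ≤ b → c ≤ dist (g u) (g v) → b - a ≤ v - u := by
    intro u v h1 h2 h3 h4
    exact hmin (show (u, v) ∈ _ from
      ⟨⟨⟨⟨by linarith, by linarith⟩, by linarith, by linarith⟩, h2⟩, h4⟩)
  have hgab := hg.mono (Icc_subset_Icc hxa hby)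
  have hlt : a < b := by
    refine hab.lt_of_ne ?_
    rintro rfl
    rw [dist_self] at hdab
    linarith
  refine ⟨a, b, hxa, hlt, hby, injOn_Icc_of_shortest hgab
    (fun u v h1 h2 => ho u v (hxa.trans h1) (h2.trans hby)) hdab hmin', ?_⟩
  obtain ⟨v, hv, hgv⟩ : c ∈ (fun v => dist (g a) (g v)) '' Icc a b :=
    intermediate_value_Icc hab (continuous_dist.comp_continuousOn
      (continuousOn_const.prodMk hgab)) ⟨by simpa using hc.le, hdab⟩
  have := hmin' a v le_rfl hv.1 hv.2 hgv.ge
  have hvb : v = b := by linarith [hv.2]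
  rwa [← hvb]

/-- A free open interval is the image of `(0,1)` under an injective, continuous, open map. -/
theorem IsFreeOpenInterval.exists_param {X : Type*} [TopologicalSpace X] {J : Set X}
    (hJ : IsFreeOpenInterval J) : ∃ ψ : ℝ → X, ContinuousOn ψ (Ioo 0 1) ∧ InjOn ψ (Ioo 0 1) ∧
      ψ '' Ioo 0 1 = J ∧ ∀ V ⊆ Ioo (0:ℝ) 1, IsOpen V → IsOpen (ψ '' V) := by
  obtain ⟨hJo, ⟨e⟩⟩ := hJ
  let φ : Ioo (0:ℝ) 1 → X := fun t => (e.symm t : X)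
  have hφ : IsOpenEmbedding φ := hJo.isOpenEmbedding_subtypeVal.comp e.symm.isOpenEmbedding
  have x₀ : X := φ ⟨1 / 2, by norm_num⟩
  let ψ : ℝ → X := Function.extend Subtype.val φ fun _ => x₀
  have hr : (Ioo (0:ℝ) 1).domRestrict ψ = φ := by
    ext t
    exact Subtype.val_injective.extend_apply φ (fun _ => x₀) t
  have hrange : range φ = J := by
    ext z
    constructor
    · rintro ⟨t, rfl⟩
      exact (e.symm t).2
    · exact fun hz => ⟨e ⟨z, hz⟩, by simp [φ]⟩
  refine ⟨ψ, ?_, ?_, ?_, fun V hV hVo => ?_⟩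
  · rw [continuousOn_iff_continuous_domRestrict, hr]
    exact hφ.continuous
  · rw [injOn_iff_injective, hr]
    exact hφ.injective
  · rw [← range_domRestrict, hr, hrange]
  · have : ψ '' V = φ '' (Subtype.val ⁻¹' V) := by
      rw [← hr, Set.domRestrict_eq, image_comp, Subtype.image_preimage_coe, inter_eq_right.2 hV]
    rw [this]
    exact hφ.isOpenMap _ (hVo.preimage continuous_subtype_val)

/-- Claim C: For a sensitive commutative open-map semigroup `F`
with sensitivity constant `c` on a Peano continuum with a free arc, neither arc
nor circle, and a free arc `K` inside a maximal free open interval, there are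
`g ∈ F` and a subarc `L ⊆ K` such that `g(L)` is a free arc whose two endpoints
are at distance exactly `c`. -/
theorem stmt_15 (X : Type*) [MetricSpace X] [CompactSpace X] [ConnectedSpace X]
    [LocallyConnectedSpace X]
    (hfree : ∃ A : Set X, IsFreeArc A)
    (harc : ¬ SpaceIsArc X) (hcirc : ¬ SpaceIsCircle X)
    (F : Set (X → X))
    (hcont : ∀ f ∈ F, Continuous f)
    (hopen : ∀ f ∈ F, IsOpenMap f)
    (hsemi : ∀ f ∈ F, ∀ g ∈ F, f ∘ g ∈ F)
    (hcomm : ∀ f ∈ F, ∀ g ∈ F, f ∘ g = g ∘ f)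
    (c : ℝ) (hc : 0 < c)
    (hsens : ∀ U : Set X, IsOpen U → U.Nonempty → ∃ f ∈ F, c < Metric.diam (f '' U))
    (K J : Set X) (hJ : IsMaxFreeOpenInterval J)
    (hK : IsFreeArc K) (hKJ : K ⊆ J) :
    ∃ g ∈ F, ∃ L : Set X, L ⊆ K ∧ IsArc L ∧ IsFreeArc (g '' L) ∧
      ∃ p q : X, IsArcEnds (g '' L) p q ∧ dist p q = c := by
  obtain ⟨I, hI, rfl, -⟩ := hK
  obtain ⟨ψ, hψc, hψi, hψI, hψo⟩ := hI.exists_param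
  have hne : I.Nonempty := hψI ▸ (nonempty_Ioo.2 zero_lt_one).image ψ
  obtain ⟨f, hf, hdiam⟩ := hsens I hI.1 hne
  have hgc : ContinuousOn (f ∘ ψ) (Ioo 0 1) := (hcont f hf).comp_continuousOn hψc
  obtain ⟨x, hx, y, hy, hxy, hd⟩ : ∃ x ∈ Ioo (0:ℝ) 1, ∃ y ∈ Ioo (0:ℝ) 1, x ≤ y ∧
      c ≤ dist ((f ∘ ψ) x) ((f ∘ ψ) y) := by
    by_contra! hcon
    refine hdiam.not_ge (diam_le_of_forall_dist_le hc.le ?_)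
    rw [← hψI, ← image_comp]
    rintro _ ⟨u, hu, rfl⟩ _ ⟨v, hv, rfl⟩
    rcases le_total u v with h | h
    · exact (hcon u hu v hv h).le
    · rw [dist_comm]
      exact (hcon v hv u hu h).le
  have hsub : ∀ a b, x ≤ a → b ≤ y → Icc a b ⊆ Ioo (0:ℝ) 1 :=
    fun a b ha hb t ht => ⟨hx.1.trans_le (ha.trans ht.1), (ht.2.trans hb).trans_lt hy.2⟩
  have ho : ∀ a b, x ≤ a → b ≤ y → IsOpen ((f ∘ ψ) '' Ioo a b) := by
    intro a b ha hb
    rw [image_comp]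
    exact hopen f hf _ (hψo _ (Ioo_subset_Icc_self.trans (hsub a b ha hb)) isOpen_Ioo)
  obtain ⟨a, b, hxa, hab, hby, hinj, hdist⟩ :=
    exists_injOn_Icc_dist_eq hc hxy (hgc.mono (hsub x y le_rfl le_rfl)) ho hd
  have hs := hsub a b hxa hby
  refine ⟨f, hf, ψ '' Icc a b, ?_,
    (isArcEnds_image_Icc hab (hψc.mono hs) (hψi.mono hs)).isArc, ?_, (f ∘ ψ) a, (f ∘ ψ) b, ?_, hdist⟩
  · exact ((image_mono hs).trans hψI.subset).trans subset_closure
  · rw [← image_comp]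
    exact isFreeArc_image_Icc hab (hgc.mono hs) hinj (ho a b hxa hby)
  · rw [← image_comp]
    exact isArcEnds_image_Icc hab (hgc.mono hs) hinj
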